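/- Let Ω be a convex body of class C²₊ in ℝⁿ, U the solution of ΔU = -2 in Ω with U = 0 on ∂Ω, F the inverse Gauss map, κ the Gauss curvature, and (c_{ij}) the cofactor matrix of the reverse Weingarten matrix (h_{ij} + h δ_{ij}). Then for all i, j at ξ ∈ S^(n-1): (∇²U(F(ξ)) e_i)·e_j = -κ·|∇U(F(ξ))|·c_{ij}(ξ). -/

import Mathlib

open scoped InnerProductSpace

/-- The Euclidean Laplacian, as the sum of second derivatives in coordinate directions. -/
noncomputable def lap {n : ℕ} (f : EuclideanSpace ℝ (Fin n) → ℝ)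
    (x : EuclideanSpace ℝ (Fin n)) : ℝ :=
  ∑ i : Fin n, fderiv ℝ (fun y => fderiv ℝ f y (EuclideanSpace.single i 1)) x
    (EuclideanSpace.single i 1)

open Filter Topology

lemma aux_expand {n : ℕ} (ξ : EuclideanSpace ℝ (Fin n)) (hξ : ‖ξ‖ = 1)
    (e : Fin (n - 1) → EuclideanSpace ℝ (Fin n)) (he : Orthonormal ℝ e)
    (heξ : ∀ i, ⟪e i, ξ⟫_ℝ = 0) (v : EuclideanSpace ℝ (Fin n)) :
    v = ⟪ξ, v⟫_ℝ • ξ + ∑ i, ⟪e i, v⟫_ℝ • e i := by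
  have hn : 0 < n := by
    rcases Nat.eq_zero_or_pos n with h0 | h0
    · subst h0
      have : ξ = 0 := Subsingleton.elim _ _
      simp [this] at hξ
    · exact h0
  let b : Option (Fin (n - 1)) → EuclideanSpace ℝ (Fin n) := fun o => o.elim ξ e
  have hb : Orthonormal ℝ b := by
    constructor
    · rintro (_ | i)
      · exact hξ
      · exact he.1 i
    · rintro (_ | i) (_ | j) hij
      · exact absurd rfl hij
      · change ⟪ξ, e j⟫_ℝ = 0
        rw [real_inner_comm]; exact heξ j
      · exact heξ i
      · exact he.2 (fun h => hij (by rw [h]))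
  have hcard : Fintype.card (Option (Fin (n - 1))) =
      Module.finrank ℝ (EuclideanSpace ℝ (Fin n)) := by
    simp; omega
  have hsp : ⊤ ≤ Submodule.span ℝ (Set.range b) := by
    have := hb.linearIndependent.span_eq_top_of_card_eq_finrank' hcard
    rw [this]
  have := (OrthonormalBasis.mk hb hsp).sum_repr' v
  rw [Fintype.sum_option] at this
  simp only [OrthonormalBasis.coe_mk] at this
  exact this.symm

lemma aux_second {g : ℝ → ℝ} (hg : ContDiff ℝ 2 g) (hm : IsLocalMin g 0) :
    0 ≤ deriv (deriv g) 0 := by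
  by_contra hneg
  push Not at hneg
  have hM := isLocalMax_of_deriv_deriv_neg hneg hm.deriv_eq_zero hg.continuous.continuousAt
  have hc : g =ᶠ[𝓝 0] fun _ => g 0 := by
    filter_upwards [hm, hM] with x h1 h2
    exact le_antisymm h2 h1
  have := hc.deriv.deriv_eq
  simp at this
  linarith

lemma aux_nonneg {n : ℕ} (Ω : Set (EuclideanSpace ℝ (Fin n)))
    (hΩc : IsCompact Ω) 
    (U : EuclideanSpace ℝ (Fin n) → ℝ)
    (hUsm : ContDiff ℝ 2 U)
    (hlap : ∀ x ∈ interior Ω, lap U x = -2)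
    (hbd : ∀ x ∈ frontier Ω, U x = 0) : ∀ x ∈ Ω, 0 ≤ U x := by
  intro x hx
  obtain ⟨x0, hx0, hmin⟩ := hΩc.exists_isMinOn ⟨x, hx⟩ hUsm.continuous.continuousOn
  refine le_trans ?_ (hmin hx)
  by_contra hneg
  have hint : x0 ∈ interior Ω := by
    by_contra hni
    have : x0 ∈ frontier Ω := by
      rw [hΩc.isClosed.frontier_eq]; exact ⟨hx0, hni⟩
    rw [hbd x0 this] at hneg
    exact hneg le_rfl
  have hloc : IsLocalMin U x0 := hmin.isLocalMin (mem_interior_iff_mem_nhds.1 hint)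
  have hl := hlap x0 hint
  have : 0 ≤ lap U x0 := by
    unfold lap
    refine Finset.sum_nonneg fun i _ => ?_
    set v : EuclideanSpace ℝ (Fin n) := EuclideanSpace.single i 1
    have hline : ∀ t : ℝ, HasDerivAt (fun t : ℝ => x0 + t • v) v t := by
      intro t
      simpa using ((hasDerivAt_id t).smul_const v).const_add x0
    have h1 : ContDiff ℝ 2 (fun t : ℝ => U (x0 + t • v)) := by fun_prop
    have hU1 : Differentiable ℝ U := hUsm.differentiable (by norm_num)
    have hU2 : Differentiable ℝ (fderiv ℝ U) :=
      (hUsm.fderiv_right (m := 1) (by norm_num)).differentiable (by norm_num)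
    have hd1 : deriv (fun t : ℝ => U (x0 + t • v)) =
        fun t => fderiv ℝ U (x0 + t • v) v := by
      funext t
      exact ((hU1 _).hasFDerivAt.comp_hasDerivAt t (hline t)).deriv
    have hU3 : Differentiable ℝ (fun y => fderiv ℝ U y v) := by fun_prop
    have hd2 : deriv (deriv (fun t : ℝ => U (x0 + t • v))) 0 =
        fderiv ℝ (fun y => fderiv ℝ U y v) x0 v := by
      rw [hd1]
      have := ((hU3 (x0 + (0:ℝ) • v)).hasFDerivAt.comp_hasDerivAt (0:ℝ) (hline 0)).deriv
      simpa [Function.comp_def] using this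
    rw [← hd2]
    refine aux_second h1 ?_
    have hc : ContinuousAt (fun t : ℝ => x0 + t • v) 0 := (hline 0).continuousAt
    have : Tendsto (fun t : ℝ => x0 + t • v) (𝓝 0) (𝓝 x0) := by
      simpa [ContinuousAt] using hc
    have := this.eventually hloc
    filter_upwards [this] with t ht
    simpa using ht
  linarith

/-- the gradient of the support function is the point with the given normal -/
lemma aux_grad {n : ℕ} (Ω : Set (EuclideanSpace ℝ (Fin n)))
    (hΩc : IsCompact Ω) 
    (h : EuclideanSpace ℝ (Fin n) → ℝ)
    (hsupp : ∀ x, h x = sSup ((fun y => ⟪x, y⟫_ℝ) '' Ω))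
    (hsm : ContDiffOn ℝ 2 h {x | x ≠ 0})
    (x p : EuclideanSpace ℝ (Fin n)) (hx : x ≠ 0) (hp : p ∈ Ω)
    (hmax : ∀ y ∈ Ω, ⟪x, y⟫_ℝ ≤ ⟪x, p⟫_ℝ) :
    gradient h x = p ∧ h x = ⟪x, p⟫_ℝ := by
  have hge : ∀ y, ⟪y, p⟫_ℝ ≤ h y := by
    intro y
    rw [hsupp]
    refine le_csSup ?_ ⟨p, hp, rfl⟩
    exact (hΩc.image (by fun_prop)).bddAbove
  have heq : h x = ⟪x, p⟫_ℝ := by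
    refine le_antisymm ?_ (hge x)
    rw [hsupp]
    refine csSup_le ⟨_, p, hp, rfl⟩ ?_
    rintro _ ⟨y, hy, rfl⟩
    exact hmax y hy
  refine ⟨?_, heq⟩
  have hd : DifferentiableAt ℝ h x :=
    (hsm.contDiffAt (isOpen_ne.mem_nhds hx)).differentiableAt (by norm_num)
  have hloc : IsLocalMin (fun y => h y - ⟪p, y⟫_ℝ) x := by
    refine Filter.Eventually.of_forall fun y => ?_
    have := hge y
    simp only [real_inner_comm] at *
    linarith
  have h2 : HasFDerivAt (fun y => h y - ⟪p, y⟫_ℝ) (fderiv ℝ h x - innerSL ℝ p) x :=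
    hd.hasFDerivAt.sub (innerSL ℝ p).hasFDerivAt
  have h3 := hloc.hasFDerivAt_eq_zero h2
  rw [gradient, sub_eq_zero.1 h3]
  exact (InnerProductSpace.toDual ℝ _).symm_apply_apply p

/-- Lemma 3.2 (i): tangential-tangential components of the Hessian of the torsion function.
In a local orthonormal frame `{e_i}` on `S^{n-1}`, with `W = (h_{ij} + h δ_{ij})`
(realized as the ambient Hessian of the 1-homogeneous support function in the tangent
directions), Gauss curvature `κ = (det W)⁻¹` and cofactor matrix `c = adjugate W`, one has
`(∇²U(F(ξ)) e_i) · e_j = -κ |∇U(F(ξ))| c_{ij}`. -/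
theorem stmt_8 (n : ℕ) (Ω : Set (EuclideanSpace ℝ (Fin n)))
    (hΩc : IsCompact Ω) (hΩconv : Convex ℝ Ω) (hΩint : (interior Ω).Nonempty)
    (h : EuclideanSpace ℝ (Fin n) → ℝ)
    (hsupp : ∀ x, h x = sSup ((fun y => ⟪x, y⟫_ℝ) '' Ω))
    -- `Ω` of class `C²₊`: `h` is `C²` away from the origin,
    (hsm : ContDiffOn ℝ 2 h {x | x ≠ 0})
    (F : EuclideanSpace ℝ (Fin n) → EuclideanSpace ℝ (Fin n))
    -- `F` is the inverse Gauss map: `F x` is the boundary point with outer normal `x`: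
    (hFmax : ∀ x, ‖x‖ = 1 → F x ∈ frontier Ω ∧ ∀ y ∈ Ω, ⟪x, y⟫_ℝ ≤ ⟪x, F x⟫_ℝ)
    (U : EuclideanSpace ℝ (Fin n) → ℝ)
    -- `U ∈ C²(closure Ω)` solves the torsion problem:
    (hUsm : ContDiff ℝ 2 U)
    (hlap : ∀ x ∈ interior Ω, lap U x = -2)
    (hbd : ∀ x ∈ frontier Ω, U x = 0)
    (ξ : EuclideanSpace ℝ (Fin n)) (hξ : ‖ξ‖ = 1)
    -- a local orthonormal frame of the tangent space at `ξ`: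
    (e : Fin (n - 1) → EuclideanSpace ℝ (Fin n)) (he : Orthonormal ℝ e)
    (heξ : ∀ i, ⟪e i, ξ⟫_ℝ = 0)
    -- the reverse Weingarten matrix `(h_{ij} + h δ_{ij})`:
    (W : Matrix (Fin (n - 1)) (Fin (n - 1)) ℝ)
    (hW : ∀ i j, W i j = iteratedFDeriv ℝ 2 h ξ ![e i, e j])
    -- `W` is positive definite (positive Gauss curvature):
    (hWpos : W.PosDef) :
    ∀ i j, iteratedFDeriv ℝ 2 U (F ξ) ![e i, e j] =
      -(W.det⁻¹ * ‖gradient U (F ξ)‖ * W.adjugate i j) := by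
  intro i j
  have hfrΩ : frontier Ω ⊆ Ω := hΩc.isClosed.frontier_subset
  -- structure of `G = ∇h`
  have hG : ∀ x, x ≠ 0 → gradient h x ∈ frontier Ω ∧ h x = ⟪x, gradient h x⟫_ℝ ∧
      gradient h x = F (‖x‖⁻¹ • x) := by
    intro x hx
    have hn : ‖‖x‖⁻¹ • x‖ = 1 := by
      rw [norm_smul, norm_inv, norm_norm, inv_mul_cancel₀ (norm_ne_zero_iff.2 hx)]
    obtain ⟨h1, h2⟩ := hFmax _ hn
    have h3 : ∀ y ∈ Ω, ⟪x, y⟫_ℝ ≤ ⟪x, F (‖x‖⁻¹ • x)⟫_ℝ := by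
      intro y hy
      have := h2 y hy
      rw [real_inner_smul_left, real_inner_smul_left] at this
      exact le_of_mul_le_mul_left this (inv_pos.2 (norm_pos_iff.2 hx))
    obtain ⟨h4, h5⟩ := aux_grad Ω hΩc h hsupp hsm x _ hx (hfrΩ h1) h3
    rw [h4]
    exact ⟨h1, h5, rfl⟩
  have hξ0 : ξ ≠ 0 := by
    rintro rfl
    simp at hξ
  have hGξ : gradient h ξ = F ξ := by
    have := (hG ξ hξ0).2.2
    simpa [hξ] using this
  set D := (InnerProductSpace.toDual ℝ (EuclideanSpace ℝ (Fin n))).symm with hD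
  have hDi : ∀ (l : StrongDual ℝ (EuclideanSpace ℝ (Fin n))) v, ⟪D l, v⟫_ℝ = l v := by
    intro l v
    exact InnerProductSpace.toDual_symm_apply
  let DL : StrongDual ℝ (EuclideanSpace ℝ (Fin n)) →L[ℝ] EuclideanSpace ℝ (Fin n) :=
    { toFun := fun l => D l
      map_add' := fun a b => map_add D a b
      map_smul' := fun r a => by simp
      cont := D.continuous }
  have hDL : ∀ (l : StrongDual ℝ (EuclideanSpace ℝ (Fin n))) v, ⟪DL l, v⟫_ℝ = l v := hDi
  let A : EuclideanSpace ℝ (Fin n) → (EuclideanSpace ℝ (Fin n) →L[ℝ] EuclideanSpace ℝ (Fin n)) :=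
    fun x => DL.comp (fderiv ℝ (fderiv ℝ h) x)
  have hne : ∀ x : EuclideanSpace ℝ (Fin n), x ≠ 0 → {x : EuclideanSpace ℝ (Fin n) | x ≠ 0} ∈ 𝓝 x :=
    fun x hx => isOpen_ne.mem_nhds hx
  have hC1 : ∀ x, x ≠ 0 → ContDiffAt ℝ 1 (fderiv ℝ h) x := fun x hx =>
    (hsm.contDiffAt (hne x hx)).fderiv_right (by norm_num)
  have hGd : ∀ x, x ≠ 0 → HasFDerivAt (gradient h) (A x) x := by
    intro x hx
    exact DL.hasFDerivAt.comp x ((hC1 x hx).differentiableAt (by norm_num)).hasFDerivAt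
  have hAc : ContinuousAt A ξ := by
    have : ContinuousAt (fderiv ℝ (fderiv ℝ h)) ξ :=
      ((hC1 ξ hξ0).fderiv_right (m := 0) (by norm_num)).continuousAt
    exact continuousAt_const.clm_comp this
  -- Euler relation
  have hxA : ∀ x, x ≠ 0 → ∀ v, ⟪x, A x v⟫_ℝ = 0 := by
    intro x hx v
    have h1 : HasFDerivAt h (fderiv ℝ h x) x :=
      ((hsm.contDiffAt (hne x hx)).differentiableAt (by norm_num)).hasFDerivAt
    have h2 := (hasFDerivAt_id (𝕜 := ℝ) x).inner ℝ (hGd x hx)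
    have h3 : h =ᶠ[𝓝 x] fun y => ⟪id y, gradient h y⟫_ℝ := by
      filter_upwards [hne x hx] with y hy
      exact (hG y hy).2.1
    have h4 := congrArg (fun l => l v) (h1.unique (h2.congr_of_eventuallyEq h3))
    have h5 : fderiv ℝ h x v = ⟪gradient h x, v⟫_ℝ := (hDi _ v).symm
    simp [fderivInnerCLM_apply] at h4
    exact h4
  -- gradient of U
  have hU1 : Differentiable ℝ U := hUsm.differentiable (by norm_num)
  have hU2 : Differentiable ℝ (fderiv ℝ U) :=
    (hUsm.fderiv_right (m := 1) (by norm_num)).differentiable (by norm_num)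
  have hUi : ∀ p v, ⟪gradient U p, v⟫_ℝ = fderiv ℝ U p v := fun p v => hDi _ v
  have hUA : ∀ x, x ≠ 0 → ∀ v, ⟪gradient U (gradient h x), A x v⟫_ℝ = 0 := by
    intro x hx v
    have h1 : HasFDerivAt (fun y => U (gradient h y))
        ((fderiv ℝ U (gradient h x)).comp (A x)) x :=
      (hU1 _).hasFDerivAt.comp x (hGd x hx)
    have h2 : (fun y => U (gradient h y)) =ᶠ[𝓝 x] fun _ => (0 : ℝ) := by
      filter_upwards [hne x hx] with y hy
      exact hbd _ (hG y hy).1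
    have h3 := h1.unique ((hasFDerivAt_const (0 : ℝ) x).congr_of_eventuallyEq h2)
    have h4 := congrArg (fun l => l v) h3
    rw [hUi]
    simpa using h4
  -- W in terms of A
  have hWA : ∀ k l, W k l = ⟪A ξ (e k), e l⟫_ℝ := by
    intro k l
    rw [hW, iteratedFDeriv_two_apply]
    exact (hDL _ _).symm
  have hAe : ∀ k, A ξ (e k) = ∑ l, W k l • e l := by
    intro k
    have := aux_expand ξ hξ e he heξ (A ξ (e k))
    rw [hxA ξ hξ0, zero_smul, zero_add] at this
    rw [this]
    refine Finset.sum_congr rfl fun l _ => ?_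
    rw [hWA, real_inner_comm]
  -- B
  let B : EuclideanSpace ℝ (Fin n) → (EuclideanSpace ℝ (Fin n) →L[ℝ] EuclideanSpace ℝ (Fin n)) :=
    fun x => A x + (innerSL ℝ x).smulRight x
  have hBv : ∀ x v, B x v = A x v + ⟪x, v⟫_ℝ • x := fun x v => by simp [B]
  have hBc : ContinuousAt B ξ := by
    refine hAc.add ?_
    have : Continuous fun x : EuclideanSpace ℝ (Fin n) => (innerSL ℝ x).smulRight x := by
      fun_prop
    exact this.continuousAt
  have hBinj : Function.Injective (B ξ) := by
    rw [injective_iff_map_eq_zero]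
    intro v hv
    have h1 : ⟪ξ, v⟫_ℝ = 0 := by
      have : ⟪ξ, B ξ v⟫_ℝ = 0 := by rw [hv, inner_zero_right]
      rw [hBv, inner_add_right, hxA ξ hξ0, real_inner_smul_right, real_inner_self_eq_norm_sq,
        hξ] at this
      linarith
    have h2 := aux_expand ξ hξ e he heξ v
    rw [h1, zero_smul, zero_add] at h2
    have h3 : A ξ v = 0 := by
      rw [hBv, h1, zero_smul, add_zero] at hv; exact hv
    set a : Fin (n - 1) → ℝ := fun k => ⟪e k, v⟫_ℝ with ha
    by_cases ha0 : a = 0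
    · rw [h2]
      exact Finset.sum_eq_zero fun k _ => by
        have : ⟪e k, v⟫_ℝ = 0 := congrFun ha0 k
        rw [this, zero_smul]
    · exfalso
      have h4 := hWpos.dotProduct_mulVec_pos ha0
      have h5 : ⟪A ξ v, v⟫_ℝ = 0 := by rw [h3, inner_zero_left]
      have h6 : ⟪A ξ v, v⟫_ℝ = star a ⬝ᵥ W.mulVec a := by
        conv_lhs => rw [h2]
        simp only [map_sum, map_smul, sum_inner, inner_sum, real_inner_smul_left,
          real_inner_smul_right, ← hWA, dotProduct, Matrix.mulVec, Finset.mul_sum, Pi.star_apply,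
          star_trivial]
        rw [Finset.sum_comm]
        refine Finset.sum_congr rfl fun k _ => Finset.sum_congr rfl fun l _ => ?_
        simp only [ha]
        ring
      linarith
  have hBsurj : ∀ᶠ x in 𝓝 ξ, Function.Surjective (B x) := by
    let L : EuclideanSpace ℝ (Fin n) ≃L[ℝ] EuclideanSpace ℝ (Fin n) :=
      (LinearEquiv.ofInjectiveEndo (B ξ : EuclideanSpace ℝ (Fin n) →ₗ[ℝ] _)
        hBinj).toContinuousLinearEquiv
    have hL : (L : EuclideanSpace ℝ (Fin n) →L[ℝ] EuclideanSpace ℝ (Fin n)) = B ξ := by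
      ext1 v; rfl
    have h1 := ContinuousLinearEquiv.nhds L
    rw [hL] at h1
    filter_upwards [hBc.eventually h1] with x hx
    obtain ⟨M, hM⟩ := hx
    rw [← hM]
    exact M.surjective
  let c : EuclideanSpace ℝ (Fin n) → ℝ := fun x => ⟪gradient U (gradient h x), x⟫_ℝ / ‖x‖ ^ 2
  have hpar : ∀ᶠ x in 𝓝 ξ, gradient U (gradient h x) = c x • x := by
    filter_upwards [hBsurj, hne ξ hξ0] with x hs hx
    rw [← sub_eq_zero]
    obtain ⟨v, hv⟩ := hs (gradient U (gradient h x) - c x • x)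
    have hx2 : ‖x‖ ^ 2 ≠ 0 := pow_ne_zero _ (norm_ne_zero_iff.2 hx)
    rw [← inner_self_eq_zero (𝕜 := ℝ)]
    conv_lhs => rw [← hv]
    rw [hv]
    nth_rewrite 2 [← hv]
    rw [hBv, inner_sub_left, inner_add_right, inner_add_right, hUA x hx, real_inner_smul_left,
      real_inner_smul_left, hxA x hx, real_inner_smul_right, real_inner_smul_right,
      real_inner_self_eq_norm_sq]
    simp only [c]
    field_simp
    ring
  have hcξ : gradient U (F ξ) = c ξ • ξ := by
    rw [← hGξ]; exact hpar.self_of_nhds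
  -- sign of c
  have hcle : c ξ ≤ 0 := by
    obtain ⟨q, hq⟩ := hΩint
    obtain ⟨hFf, hFm⟩ := hFmax ξ hξ
    have hUn := aux_nonneg Ω hΩc U hUsm hlap hbd
    have hlt : ⟪ξ, q⟫_ℝ < ⟪ξ, F ξ⟫_ℝ := by
      have hc : Tendsto (fun t : ℝ => q + t • ξ) (𝓝[>] 0) (𝓝 q) := by
        have : Continuous (fun t : ℝ => q + t • ξ) := by fun_prop
        have := this.tendsto 0
        rw [zero_smul, add_zero] at this
        exact this.mono_left nhdsWithin_le_nhds
      obtain ⟨t, ht1, ht2⟩ :=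
        ((hc.eventually (mem_interior_iff_mem_nhds.1 hq)).and self_mem_nhdsWithin).exists
      have := hFm _ ht1
      rw [inner_add_right, real_inner_smul_right, real_inner_self_eq_norm_sq, hξ] at this
      have : (0:ℝ) < t := ht2
      linarith
    have hder : 0 ≤ fderiv ℝ U (F ξ) (q - F ξ) := by
      have hline : HasDerivAt (fun t : ℝ => F ξ + t • (q - F ξ)) (q - F ξ) 0 := by
        simpa using ((hasDerivAt_id (0:ℝ)).smul_const (q - F ξ)).const_add (F ξ)
      have h1 := (hU1 (F ξ + (0:ℝ) • (q - F ξ))).hasFDerivAt.comp_hasDerivAt (0:ℝ) hline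
      rw [zero_smul, add_zero] at h1
      have h2 := h1.tendsto_slope_zero_right
      refine ge_of_tendsto h2 ?_
      have : Set.Ioc (0:ℝ) 1 ∈ 𝓝[>] (0:ℝ) := Ioc_mem_nhdsGT one_pos
      filter_upwards [this] with t ht
      have hmem : F ξ + t • (q - F ξ) ∈ Ω :=
        hΩconv.add_smul_sub_mem (hfrΩ hFf) (interior_subset hq) ⟨ht.1.le, ht.2⟩
      have h3 := hUn _ hmem
      have h4 := hbd _ hFf
      simp only [Function.comp, zero_add, zero_smul, add_zero, h4, sub_zero, smul_eq_mul]
      exact mul_nonneg (inv_nonneg.2 ht.1.le) h3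
    rw [← hUi, hcξ, real_inner_smul_left, inner_sub_right] at hder
    by_contra hcon
    push Not at hcon
    nlinarith
  have hnorm : ‖gradient U (F ξ)‖ = - c ξ := by
    rw [hcξ, norm_smul, hξ, mul_one, Real.norm_eq_abs, abs_of_nonpos hcle]
  -- differentiate
  let H : Matrix (Fin (n - 1)) (Fin (n - 1)) ℝ :=
    fun k l => fderiv ℝ (fderiv ℝ U) (F ξ) (e k) (e l)
  have hgU : ∀ p, HasFDerivAt (gradient U) (DL.comp (fderiv ℝ (fderiv ℝ U) p)) p := fun p =>
    DL.hasFDerivAt.comp p (hU2 p).hasFDerivAt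
  have hgUG : HasFDerivAt (fun x => gradient U (gradient h x))
      ((DL.comp (fderiv ℝ (fderiv ℝ U) (gradient h ξ))).comp (A ξ)) ξ :=
    (hgU _).comp ξ (hGd ξ hξ0)
  have hcd : DifferentiableAt ℝ c ξ := by
    have h1 : DifferentiableAt ℝ (fun x => ⟪gradient U (gradient h x), x⟫_ℝ) ξ :=
      hgUG.differentiableAt.inner ℝ differentiableAt_id
    have h2 : DifferentiableAt ℝ (fun x : EuclideanSpace ℝ (Fin n) => ‖x‖ ^ 2) ξ :=
      differentiableAt_id.norm_sq ℝ
    have h0 : ‖ξ‖ ^ 2 ≠ 0 := by simp [hξ]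
    have h3 := h1.fun_mul (h2.fun_inv h0)
    simpa only [c, div_eq_mul_inv] using h3
  have hmain : W * H = c ξ • (1 : Matrix (Fin (n - 1)) (Fin (n - 1)) ℝ) := by
    ext k l
    have h1 := (hcd.hasFDerivAt.smul (hasFDerivAt_id (𝕜 := ℝ) ξ)).congr_of_eventuallyEq hpar
    have h2 := congrArg (fun T => ⟪T (e k), e l⟫_ℝ) (hgUG.unique h1)
    have hξe : ⟪ξ, e l⟫_ℝ = 0 := by rw [real_inner_comm]; exact heξ l
    simp only [ContinuousLinearMap.comp_apply, hAe, hGξ, map_sum, map_smul, sum_inner,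
      add_apply, smul_apply,
      ContinuousLinearMap.smulRight_apply, ContinuousLinearMap.id_apply, id, inner_add_left,
      real_inner_smul_left, hDL, hξe, mul_zero, add_zero] at h2
    rw [Matrix.mul_apply, Matrix.smul_apply, Matrix.one_apply, smul_eq_mul]
    rw [orthonormal_iff_ite.1 he] at h2
    exact h2
  have hdet : W.det ≠ 0 := hWpos.det_pos.ne'
  have hHW : H = c ξ • (W.det⁻¹ • W.adjugate) := by
    have h1 : W.adjugate * (W * H) = W.adjugate * (c ξ • 1) := by rw [hmain]
    rw [← Matrix.mul_assoc, Matrix.adjugate_mul, Matrix.smul_mul, Matrix.one_mul,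
      Matrix.mul_smul, Matrix.mul_one] at h1
    rw [smul_comm, ← h1, smul_smul, inv_mul_cancel₀ hdet, one_smul]
  rw [iteratedFDeriv_two_apply, hnorm]
  have := congrFun (congrFun hHW i) j
  simp only [Matrix.smul_apply, smul_eq_mul] at this
  change H i j = _
  rw [this]
  ring
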